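/- Let u, v : ℝ³ → ℝ³ be twice continuously differentiable with ∇·u = 0 and ∇·v = 0, and set w_u = ∇×u, w_v = ∇×v. Then ∇×((v·∇)u) = ½( −∇×(∇×(v×u)) + (u·∇)w_v − (w_v·∇)u + (v·∇)w_u − (w_u·∇)v ). -/

import Mathlib

open MeasureTheory

noncomputable section

abbrev V3 := Fin 3 → ℝ

/-- spatial partial derivative ∂ᵢf -/
def pd (i : Fin 3) (f : V3 → ℝ) (x : V3) : ℝ := fderiv ℝ f x (Pi.single i 1)

/-- Laplacian of a scalar function -/
def lap (f : V3 → ℝ) (x : V3) : ℝ := ∑ i, pd i (pd i f) x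

/-- ℤ³-periodicity -/
def Periodic3 (f : V3 → ℝ) : Prop :=
  ∀ (x : V3) (k : Fin 3 → ℤ), f (x + fun i => (k i : ℝ)) = f x

/-- mollification Jf = η ∗ f -/
def J3 (η f : V3 → ℝ) (x : V3) : ℝ := ∫ y, η (x - y) * f y

/-- curl ∇×u -/
def curl3 (u : V3 → V3) (x : V3) : V3 :=
  ![pd 1 (fun y => u y 2) x - pd 2 (fun y => u y 1) x,
    pd 2 (fun y => u y 0) x - pd 0 (fun y => u y 2) x,
    pd 0 (fun y => u y 1) x - pd 1 (fun y => u y 0) x]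

/-- (v·∇)u -/
def advect (v u : V3 → V3) (x : V3) : V3 :=
  fun i => ∑ j, v x j * pd j (fun y => u y i) x

/-- the bilinear term Ω(v,u) -/
def Omg (v u : V3 → V3) (x : V3) : V3 :=
  ![∑ j, (pd 1 (fun y => v y j) x * pd j (fun y => u y 2) x
      - pd 2 (fun y => v y j) x * pd j (fun y => u y 1) x),
    ∑ j, (pd 2 (fun y => v y j) x * pd j (fun y => u y 0) x
      - pd 0 (fun y => v y j) x * pd j (fun y => u y 2) x),
    ∑ j, (pd 0 (fun y => v y j) x * pd j (fun y => u y 1) x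
      - pd 1 (fun y => v y j) x * pd j (fun y => u y 0) x)]

/-- pointwise cross product -/
def cross (a b : V3) : V3 :=
  ![a 1 * b 2 - a 2 * b 1, a 2 * b 0 - a 0 * b 2, a 0 * b 1 - a 1 * b 0]

theorem pd_add {f g : V3 → ℝ} {x : V3} (i : Fin 3) (hf : DifferentiableAt ℝ f x)
    (hg : DifferentiableAt ℝ g x) : pd i (fun y => f y + g y) x = pd i f x + pd i g x := by
  simp [pd, fderiv_fun_add hf hg]

theorem pd_sub {f g : V3 → ℝ} {x : V3} (i : Fin 3) (hf : DifferentiableAt ℝ f x)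
    (hg : DifferentiableAt ℝ g x) : pd i (fun y => f y - g y) x = pd i f x - pd i g x := by
  simp [pd, fderiv_fun_sub hf hg]

theorem pd_mul {f g : V3 → ℝ} {x : V3} (i : Fin 3) (hf : DifferentiableAt ℝ f x)
    (hg : DifferentiableAt ℝ g x) :
    pd i (fun y => f y * g y) x = pd i f x * g x + f x * pd i g x := by
  simp [pd, fderiv_fun_mul hf hg]
  ring

theorem differentiable_pd {f : V3 → ℝ} (hf : ContDiff ℝ 2 f) (i : Fin 3) :
    Differentiable ℝ (pd i f) :=
  ((hf.fderiv_right (m := 1) (by norm_num)).differentiable one_ne_zero).clm_apply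
    (differentiable_const _)

theorem pd_pd_eq {f : V3 → ℝ} (hf : ContDiff ℝ 2 f) (i j : Fin 3) (x : V3) :
    pd i (pd j f) x = fderiv ℝ (fderiv ℝ f) x (Pi.single i 1) (Pi.single j 1) := by
  have h : DifferentiableAt ℝ (fderiv ℝ f) x :=
    ((hf.fderiv_right (m := 1) (by norm_num)).differentiable one_ne_zero) x
  change fderiv ℝ (fun y => fderiv ℝ f y (Pi.single j 1)) x (Pi.single i 1) = _
  rw [fderiv_clm_apply h (differentiableAt_const _)]
  simp

theorem pd_comm {f : V3 → ℝ} (hf : ContDiff ℝ 2 f) (i j : Fin 3) (x : V3) :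
    pd i (pd j f) x = pd j (pd i f) x := by
  rw [pd_pd_eq hf, pd_pd_eq hf]
  exact (hf.contDiffAt.isSymmSndFDerivAt (by simp)) _ _

theorem contDiff_component {u : V3 → V3} (hu : ContDiff ℝ 2 u) (i : Fin 3) :
    ContDiff ℝ 2 (fun y => u y i) :=
  contDiff_pi.mp hu i

theorem differentiable_component {u : V3 → V3} (hu : ContDiff ℝ 2 u) (i : Fin 3) :
    Differentiable ℝ (fun y => u y i) :=
  (contDiff_component hu i).differentiable two_ne_zero

theorem differentiable_advect {u v : V3 → V3} (hu : ContDiff ℝ 2 u) (hv : ContDiff ℝ 2 v)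
    (i : Fin 3) : Differentiable ℝ (fun y => advect v u y i) :=
  Differentiable.fun_sum fun j _ =>
    (differentiable_component hv j).mul (differentiable_pd (contDiff_component hu i) j)

theorem pd_advect {u v : V3 → V3} (hu : ContDiff ℝ 2 u) (hv : ContDiff ℝ 2 v)
    (k i : Fin 3) (x : V3) :
    pd k (fun y => advect v u y i) x =
      ∑ j, (pd k (fun y => v y j) x * pd j (fun y => u y i) x
        + v x j * pd k (pd j (fun y => u y i)) x) := by
  have hm : ∀ j, DifferentiableAt ℝ (fun y => v y j * pd j (fun z => u z i) y) x := fun j =>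
    ((differentiable_component hv j).mul (differentiable_pd (contDiff_component hu i) j)) x
  simp only [advect, Fin.sum_univ_three]
  rw [pd_add k ((hm 0).fun_add (hm 1)) (hm 2), pd_add k (hm 0) (hm 1)]
  simp only [pd_mul k (differentiable_component hv _ x)
    (differentiable_pd (contDiff_component hu i) _ x)]

theorem pd_curl3 {u : V3 → V3} (hu : ContDiff ℝ 2 u) (k : Fin 3) (x : V3) :
    pd k (fun y => curl3 u y 0) x
        = pd k (pd 1 (fun y => u y 2)) x - pd k (pd 2 (fun y => u y 1)) x ∧
      pd k (fun y => curl3 u y 1) x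
        = pd k (pd 2 (fun y => u y 0)) x - pd k (pd 0 (fun y => u y 2)) x ∧
      pd k (fun y => curl3 u y 2) x
        = pd k (pd 0 (fun y => u y 1)) x - pd k (pd 1 (fun y => u y 0)) x := by
  have hd : ∀ i j, DifferentiableAt ℝ (pd j (fun y => u y i)) x := fun i j =>
    differentiable_pd (contDiff_component hu i) j x
  exact ⟨pd_sub k (hd _ _) (hd _ _), pd_sub k (hd _ _) (hd _ _), pd_sub k (hd _ _) (hd _ _)⟩

theorem curl3_sub {a b : V3 → V3} {x : V3} (ha : ∀ i, DifferentiableAt ℝ (fun y => a y i) x)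
    (hb : ∀ i, DifferentiableAt ℝ (fun y => b y i) x) :
    curl3 (fun y => a y - b y) x = curl3 a x - curl3 b x := by
  have h : ∀ k i, pd k (fun y => (a y - b y) i) x
      = pd k (fun y => a y i) x - pd k (fun y => b y i) x := fun k i => pd_sub k (ha i) (hb i)
  ext i
  fin_cases i <;> simp [curl3, - Pi.sub_apply, h] <;> ring

theorem curl3_cross {u v : V3 → V3} (hu : Differentiable ℝ u) (hv : Differentiable ℝ v)
    (hdivu : ∀ x, (∑ i, pd i (fun y => u y i) x) = 0)
    (hdivv : ∀ x, (∑ i, pd i (fun y => v y i) x) = 0) (x : V3) :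
    curl3 (fun y => cross (v y) (u y)) x = advect u v x - advect v u x := by
  have du : ∀ i, DifferentiableAt ℝ (fun y => u y i) x := fun i => differentiable_pi.mp hu i x
  have dv : ∀ i, DifferentiableAt ℝ (fun y => v y i) x := fun i => differentiable_pi.mp hv i x
  have h : ∀ k i j, pd k (fun y => v y i * u y j - v y j * u y i) x
      = pd k (fun y => v y i) x * u x j + v x i * pd k (fun y => u y j) x
        - (pd k (fun y => v y j) x * u x i + v x j * pd k (fun y => u y i) x) := fun k i j => by
    rw [pd_sub k ((dv i).fun_mul (du j)) ((dv j).fun_mul (du i)), pd_mul k (dv i) (du j),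
      pd_mul k (dv j) (du i)]
  have h1 := hdivu x
  have h2 := hdivv x
  simp only [Fin.sum_univ_three] at h1 h2
  ext i
  fin_cases i <;> simp [curl3, cross, advect, h, Fin.sum_univ_three]
  · linear_combination v x 0 * h1 - u x 0 * h2
  · linear_combination v x 1 * h1 - u x 1 * h2
  · linear_combination v x 2 * h1 - u x 2 * h2

theorem curl3_advect_add_curl3_advect {u v : V3 → V3} (hu : ContDiff ℝ 2 u) (hv : ContDiff ℝ 2 v)
    (hdivu : ∀ x, (∑ i, pd i (fun y => u y i) x) = 0)
    (hdivv : ∀ x, (∑ i, pd i (fun y => v y i) x) = 0) (x : V3) :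
    curl3 (advect v u) x + curl3 (advect u v) x
      = advect u (curl3 v) x - advect (curl3 v) u x
        + advect v (curl3 u) x - advect (curl3 u) v x := by
  have h1 := hdivu x
  have h2 := hdivv x
  have cu := fun i => pd_comm (contDiff_component hu i)
  have cv := fun i => pd_comm (contDiff_component hv i)
  have av : ∀ (a b : V3 → V3) i, advect a b x i = ∑ j, a x j * pd j (fun y => b y i) x :=
    fun _ _ _ => rfl
  have c0 : ∀ a : V3 → V3, curl3 a x 0 = pd 1 (fun y => a y 2) x - pd 2 (fun y => a y 1) x :=
    fun _ => rfl
  have c1 : ∀ a : V3 → V3, curl3 a x 1 = pd 2 (fun y => a y 0) x - pd 0 (fun y => a y 2) x :=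
    fun _ => rfl
  have c2 : ∀ a : V3 → V3, curl3 a x 2 = pd 0 (fun y => a y 1) x - pd 1 (fun y => a y 0) x :=
    fun _ => rfl
  have pu := fun k => pd_curl3 hu k x
  have pv := fun k => pd_curl3 hv k x
  simp only [Fin.sum_univ_three] at h1 h2
  ext i
  fin_cases i <;>
    simp only [Fin.zero_eta, Fin.mk_one, Fin.reduceFinMk, Pi.add_apply, Pi.sub_apply, av, c0, c1,
      c2, pd_advect hu hv, pd_advect hv hu, Fin.sum_univ_three, (pu _).1, (pu _).2.1,
      (pu _).2.2, (pv _).1, (pv _).2.1, (pv _).2.2, cu _ 1 0, cu _ 2 0, cu _ 2 1,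
      cv _ 1 0, cv _ 2 0, cv _ 2 1]
  · linear_combination (pd 1 (fun y => u y 2) x - pd 2 (fun y => u y 1) x) * h2
      + (pd 1 (fun y => v y 2) x - pd 2 (fun y => v y 1) x) * h1
  · linear_combination (pd 2 (fun y => u y 0) x - pd 0 (fun y => u y 2) x) * h2
      + (pd 2 (fun y => v y 0) x - pd 0 (fun y => v y 2) x) * h1
  · linear_combination (pd 0 (fun y => u y 1) x - pd 1 (fun y => u y 0) x) * h2
      + (pd 0 (fun y => v y 1) x - pd 1 (fun y => v y 0) x) * h1

/-- for C² divergence-free fields u, v with w_u = ∇×u, w_v = ∇×v,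
    ∇×((v·∇)u) = ½(−∇×(∇×(v×u)) + (u·∇)w_v − (w_v·∇)u + (v·∇)w_u − (w_u·∇)v). -/
theorem curl_advect_formula (u v : V3 → V3)
    (hu : ContDiff ℝ 2 u) (hv : ContDiff ℝ 2 v)
    (hdivu : ∀ x, (∑ i, pd i (fun y => u y i) x) = 0)
    (hdivv : ∀ x, (∑ i, pd i (fun y => v y i) x) = 0) :
    ∀ x : V3, curl3 (advect v u) x
      = ((1:ℝ)/2) • (- curl3 (curl3 (fun y => cross (v y) (u y))) x
          + advect u (curl3 v) x - advect (curl3 v) u x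
          + advect v (curl3 u) x - advect (curl3 u) v x) := by
  intro x
  have hcross : curl3 (fun y => cross (v y) (u y)) = fun y => advect u v y - advect v u y :=
    funext (curl3_cross (hu.differentiable two_ne_zero) (hv.differentiable two_ne_zero)
      hdivu hdivv)
  have hcc : curl3 (curl3 (fun y => cross (v y) (u y))) x
      = curl3 (advect u v) x - curl3 (advect v u) x := by
    rw [hcross]
    exact curl3_sub (fun i => differentiable_advect hv hu i x)
      (fun i => differentiable_advect hu hv i x)
  have hsum := curl3_advect_add_curl3_advect hu hv hdivu hdivv x
  rw [hcc]
  ext i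
  have hi := congrFun hsum i
  simp only [Pi.add_apply, Pi.sub_apply, Pi.neg_apply, Pi.smul_apply, smul_eq_mul] at hi ⊢
  linear_combination (1 / 2 : ℝ) * hi
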